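/- If f(z) = Σₙ₌₁^∞ aₙzⁿ is analytic in the unit disk and subordinate to g(z) = Σₙ₌₁^∞ Aₙzⁿ, where the real coefficients Aₙ form a nonnegative, nondecreasing, convex sequence (with A₀ = 0), then |aₙ| ≤ Aₙ for all n ≥ 1. -/

import Mathlib

/-- Multiplication by `Φ` does not increase the `ℓ²` norm of any initial segment of coefficients. -/
def PowerSeries.IsContractiveMultiplier (Φ : PowerSeries ℂ) : Prop :=
  ∀ (N : ℕ) (V : PowerSeries ℂ),
    ∑ k ∈ Finset.range N, ‖PowerSeries.coeff k (Φ * V)‖ ^ 2 ≤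
      ∑ k ∈ Finset.range N, ‖PowerSeries.coeff k V‖ ^ 2

open PowerSeries in
theorem PowerSeries.IsContractiveMultiplier.of_X_mul {Ψ : PowerSeries ℂ}
    (hΦ : (X * Ψ).IsContractiveMultiplier) : Ψ.IsContractiveMultiplier := by
  intro N V
  have h := hΦ (N + 1) (trunc N V : Polynomial ℂ)
  rw [Finset.sum_range_succ', Finset.sum_range_succ] at h
  simp only [mul_assoc, coeff_succ_X_mul, coeff_zero_X_mul, Polynomial.coeff_coe, coeff_trunc,
    lt_irrefl, if_false, norm_zero, ne_eq, OfNat.ofNat_ne_zero, not_false_eq_true, zero_pow,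
    add_zero] at h
  calc _ = ∑ k ∈ Finset.range N,
        ‖coeff k (Ψ * ((trunc N V : Polynomial ℂ) : PowerSeries ℂ))‖ ^ 2 := by
        refine Finset.sum_congr rfl fun k hk ↦ ?_
        rw [coeff_mul_eq_coeff_trunc_mul_trunc Ψ V (Finset.mem_range.1 hk),
          coeff_mul_eq_coeff_trunc_mul_trunc Ψ ((trunc N V : Polynomial ℂ) : PowerSeries ℂ)
            (Finset.mem_range.1 hk),
          trunc_trunc]
    _ ≤ _ := h
    _ = _ := Finset.sum_congr rfl fun k hk ↦ by rw [if_pos (Finset.mem_range.1 hk)]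

open PowerSeries in
/-- Rogosinski's coefficient bound for the Koebe-type functions `∑ m, (m - j)⁺ z ^ m`. -/
theorem norm_coeff_sum_sub_smul_pow_le {Φ : PowerSeries ℂ} (hΦ0 : constantCoeff Φ = 0)
    (hΦ : Φ.IsContractiveMultiplier) {j n : ℕ} (hj : j < n) :
    ‖coeff n (∑ m ∈ Finset.range (n + 1), (((m - j : ℕ) : ℝ) : ℂ) • Φ ^ m)‖ ≤ (n - j : ℕ) := by
  obtain ⟨Ψ, rfl⟩ := X_dvd_iff.2 hΦ0
  have hΨ := hΦ.of_X_mul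
  obtain ⟨N, rfl⟩ := Nat.exists_eq_add_of_lt hj
  obtain ⟨S, hS⟩ : ∃ S : PowerSeries ℂ, S = 1 + X * Ψ * S := by
    have : constantCoeff (1 - X * Ψ) ≠ 0 := by simp
    refine ⟨(1 - X * Ψ)⁻¹, ?_⟩
    linear_combination PowerSeries.mul_inv_cancel _ this
  have hSb : ∀ M : ℕ, ∑ k ∈ Finset.range M, ‖coeff k S‖ ^ 2 ≤ M := by
    intro M
    induction M with
    | zero => simp
    | succ M ih =>
      have h0 : coeff 0 S = 1 := by rw [hS]; simp
      have h1 (k : ℕ) : coeff (k + 1) S = coeff k (Ψ * S) := by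
        conv_lhs => rw [hS]
        simp [mul_assoc, coeff_succ_X_mul, coeff_one]
      rw [Finset.sum_range_succ', h0]
      simp only [h1]
      push_cast
      simpa using (hΨ M S).trans ih
  have hΨpow (i M : ℕ) (V : PowerSeries ℂ) : ∑ k ∈ Finset.range M, ‖coeff k (Ψ ^ i * V)‖ ^ 2 ≤
      ∑ k ∈ Finset.range M, ‖coeff k V‖ ^ 2 := by
    induction i with
    | zero => simp
    | succ i ih => rw [pow_succ', mul_assoc]; exact (hΨ M _).trans ih
  have hkoebe (M : ℕ) : X * Ψ * S ^ 2 = ∑ k ∈ Finset.range M, (k : PowerSeries ℂ) * (X * Ψ) ^ k +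
      (X * Ψ) ^ M * ((M : PowerSeries ℂ) * S + X * Ψ * S ^ 2) := by
    induction M with
    | zero => simp
    | succ M ih =>
      rw [Finset.sum_range_succ]
      push_cast
      linear_combination ih + (X * Ψ) ^ M * ((M : PowerSeries ℂ) + X * Ψ * S) * hS
  have hsum : ∑ m ∈ Finset.range (j + N + 1 + 1), (((m - j : ℕ) : ℝ) : ℂ) • (X * Ψ) ^ m =
      (X * Ψ) ^ j * ∑ k ∈ Finset.range (N + 2), (k : PowerSeries ℂ) * (X * Ψ) ^ k := by
    rw [show j + N + 1 + 1 = j + (N + 2) by ring, Finset.sum_range_add, Finset.mul_sum,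
      Finset.sum_eq_zero, zero_add]
    · refine Finset.sum_congr rfl fun k _ ↦ ?_
      rw [Nat.add_sub_cancel_left, smul_eq_C_mul, pow_add]
      simp only [Complex.ofReal_natCast, map_natCast]
      ring
    · intro m hm
      simp [Nat.sub_eq_zero_of_le (Finset.mem_range.1 hm).le]
  have hmain : coeff (j + N + 1) (∑ m ∈ Finset.range (j + N + 1 + 1),
      (((m - j : ℕ) : ℝ) : ℂ) • (X * Ψ) ^ m) = coeff N (Ψ ^ (j + 1) * S * S) := by
    have h : ∑ m ∈ Finset.range (j + N + 1 + 1), (((m - j : ℕ) : ℝ) : ℂ) • (X * Ψ) ^ m =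
        X ^ (j + 1) * (Ψ ^ (j + 1) * S * S) - X ^ (j + N + 2) *
          (Ψ ^ (j + N + 2) * (((N + 2 : ℕ) : PowerSeries ℂ) * S + X * Ψ * S ^ 2)) := by
      rw [hsum]
      linear_combination -(X * Ψ) ^ j * hkoebe (N + 2)
    rw [h, map_sub, coeff_X_pow_mul', coeff_X_pow_mul', if_pos (by omega), if_neg (by omega),
      sub_zero]
    congr 2
    omega
  rw [hmain, coeff_mul, Finset.Nat.sum_antidiagonal_eq_sum_range_succ
    (fun a b ↦ coeff a (Ψ ^ (j + 1) * S) * coeff b S)]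
  rw [show j + N + 1 - j = N + 1 by omega]
  refine (norm_sum_le _ _).trans (le_of_sq_le_sq ?_ (by positivity))
  simp only [norm_mul]
  refine (Finset.sum_mul_sq_le_sq_mul_sq _ _ _).trans ?_
  rw [sq]
  gcongr
  · exact (hΨpow _ _ _).trans (hSb _)
  · have := Finset.sum_range_reflect (fun k ↦ ‖coeff k S‖ ^ 2) (N + 1)
    simp only [Nat.add_sub_cancel] at this
    rw [this]
    exact hSb _

theorem eq_sum_second_difference_mul {A : ℕ → ℝ} (hA0 : A 0 = 0) {m n : ℕ} (hmn : m ≤ n) :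
    A m = ∑ j ∈ Finset.range n,
      (A (j + 1) - A j - (A j - A (j - 1))) * ((m - j : ℕ) : ℝ) := by
  have hd : ∀ m, A (m + 1) - A m =
      ∑ j ∈ Finset.range (m + 1), (A (j + 1) - A j - (A j - A (j - 1))) := by
    intro m
    induction m with
    | zero => simp
    | succ m ih => rw [Finset.sum_range_succ, ← ih]; simp
  induction m with
  | zero => simp [hA0]
  | succ m ih =>
    rw [← sub_add_cancel (A (m + 1)) (A m), hd, ih (by omega), add_comm]
    have hz (j : ℕ) (hj : j ∉ Finset.range (m + 1)) : m - j = 0 ∧ m + 1 - j = 0 := by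
      rw [Finset.mem_range] at hj
      omega
    rw [← Finset.sum_subset (Finset.range_subset_range.2 hmn) (fun j _ hj ↦ by simp [hz j hj]),
      ← Finset.sum_subset (Finset.range_subset_range.2 hmn) (fun j _ hj ↦ by simp [hz j hj]),
      ← Finset.sum_add_distrib]
    refine Finset.sum_congr rfl fun j hj ↦ ?_
    rw [Nat.succ_sub (Finset.mem_range_succ_iff.1 hj)]
    push_cast
    ring

open PowerSeries in
theorem norm_coeff_sum_convex_smul_pow_le {Φ : PowerSeries ℂ} (hΦ0 : constantCoeff Φ = 0)
    (hΦ : Φ.IsContractiveMultiplier) {A : ℕ → ℝ} (hA0 : A 0 = 0) (hA1 : 0 ≤ A 1)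
    (hconv : ∀ n, A (n + 1) - A n ≤ A (n + 2) - A (n + 1)) (n : ℕ) :
    ‖coeff n (∑ m ∈ Finset.range (n + 1), (A m : ℂ) • Φ ^ m)‖ ≤ A n := by
  have hd (j : ℕ) : 0 ≤ A (j + 1) - A j - (A j - A (j - 1)) := by
    rcases j with _ | j
    · simpa [hA0] using hA1
    · simpa using hconv j
  have hsum : ∑ m ∈ Finset.range (n + 1), (A m : ℂ) • Φ ^ m = ∑ j ∈ Finset.range n,
      ((A (j + 1) - A j - (A j - A (j - 1)) : ℝ) : ℂ) •
        ∑ m ∈ Finset.range (n + 1), (((m - j : ℕ) : ℝ) : ℂ) • Φ ^ m := by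
    simp only [Finset.smul_sum, smul_smul]
    rw [Finset.sum_comm]
    refine Finset.sum_congr rfl fun m hm ↦ ?_
    rw [← Finset.sum_smul]
    congr 1
    rw [eq_sum_second_difference_mul hA0 (Finset.mem_range_succ_iff.1 hm)]
    push_cast
    rfl
  rw [hsum, map_sum, eq_sum_second_difference_mul hA0 le_rfl]
  refine (norm_sum_le _ _).trans (Finset.sum_le_sum fun j hj ↦ ?_)
  rw [coeff_smul, smul_eq_mul, norm_mul, Complex.norm_real, Real.norm_of_nonneg (hd j)]
  exact mul_le_mul_of_nonneg_left
    (norm_coeff_sum_sub_smul_pow_le hΦ0 hΦ (Finset.mem_range.1 hj)) (hd j)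

/-- The power series `H` converges to `h` on the open unit disc. -/
def PowerSeries.Represents (H : PowerSeries ℂ) (h : ℂ → ℂ) : Prop :=
  ∀ z : ℂ, ‖z‖ < 1 → HasSum (fun n ↦ PowerSeries.coeff n H * z ^ n) (h z)

namespace PowerSeries.Represents

variable {H K : PowerSeries ℂ} {h k : ℂ → ℂ}

theorem of_hasFPowerSeriesOnBall {p : FormalMultilinearSeries ℂ ℂ ℂ}
    (hp : HasFPowerSeriesOnBall h p 0 1) : (PowerSeries.mk p.coeff).Represents h := by
  intro z hz
  have := hp.hasSum (y := z) (by simpa [← ofReal_norm] using hz)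
  simpa [FormalMultilinearSeries.apply_eq_pow_smul_coeff, mul_comm] using this

theorem hasFPowerSeriesOnBall (hH : H.Represents h) :
    HasFPowerSeriesOnBall h (.ofScalars ℂ fun n ↦ coeff n H) 0 1 where
  r_le := by
    refine le_of_forall_lt_imp_le_of_dense fun r hr ↦ ?_
    lift r to NNReal using hr.ne_top
    apply FormalMultilinearSeries.le_radius_of_summable
    simpa using (hH (r : ℂ) (by simpa using hr)).summable.norm
  r_pos := by simp
  hasSum := by
    intro y hy
    have hy' : ‖y‖ < 1 := by simpa [← ofReal_norm] using hy
    simpa [mul_comm] using hH y hy'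

theorem differentiableOn (hH : H.Represents h) : DifferentiableOn ℂ h (Metric.ball 0 1) := by
  simpa [← Metric.eball_ofReal] using hH.hasFPowerSeriesOnBall.differentiableOn

theorem unique (hH : H.Represents h) (hK : K.Represents h) : H = K := by
  ext n
  simpa using congrArg (fun p ↦ p.coeff n)
    (hH.hasFPowerSeriesOnBall.hasFPowerSeriesAt.eq_formalMultilinearSeries
      hK.hasFPowerSeriesOnBall.hasFPowerSeriesAt)

theorem congr (hH : H.Represents h) (hk : ∀ z, ‖z‖ < 1 → h z = k z) : H.Represents k :=
  fun z hz ↦ hk z hz ▸ hH z hz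

theorem add (hH : H.Represents h) (hK : K.Represents k) :
    (H + K).Represents fun z ↦ h z + k z := by
  intro z hz
  simpa [add_mul] using (hH z hz).add (hK z hz)

theorem smul (c : ℂ) (hH : H.Represents h) : (c • H).Represents fun z ↦ c * h z := by
  intro z hz
  simpa [mul_assoc] using (hH z hz).mul_left c

theorem mul (hH : H.Represents h) (hK : K.Represents k) :
    (H * K).Represents fun z ↦ h z * k z := by
  intro z hz
  have hs := summable_norm_sum_mul_antidiagonal_of_summable_norm
    (hH z hz).summable.norm (hK z hz).summable.norm
  have ht := tsum_mul_tsum_eq_tsum_sum_antidiagonal_of_summable_norm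
    (hH z hz).summable.norm (hK z hz).summable.norm
  rw [(hH z hz).tsum_eq, (hK z hz).tsum_eq] at ht
  change HasSum _ (h z * k z)
  rw [ht]
  convert! hs.of_norm.hasSum using 2 with n
  rw [coeff_mul, Finset.sum_mul]
  refine Finset.sum_congr rfl fun p hp ↦ ?_
  rw [← Finset.HasAntidiagonal.mem_antidiagonal.1 hp, pow_add]
  ring

theorem coe_polynomial (P : Polynomial ℂ) :
    (P : PowerSeries ℂ).Represents fun z ↦ P.eval z := by
  intro z _
  simp only [Polynomial.coeff_coe, Polynomial.eval_eq_sum_range]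
  refine hasSum_sum_of_ne_finset_zero fun n hn ↦ ?_
  rw [Polynomial.coeff_eq_zero_of_natDegree_lt (by simpa using hn), zero_mul]

theorem pow (hH : H.Represents h) (n : ℕ) : (H ^ n).Represents fun z ↦ h z ^ n := by
  induction n with
  | zero => simpa using coe_polynomial 1
  | succ n ih => simpa [pow_succ] using ih.mul hH

theorem sum {ι : Type*} (s : Finset ι) {H : ι → PowerSeries ℂ} {h : ι → ℂ → ℂ}
    (hH : ∀ i ∈ s, (H i).Represents (h i)) :
    (∑ i ∈ s, H i).Represents fun z ↦ ∑ i ∈ s, h i z := by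
  intro z hz
  simpa [Finset.sum_mul] using hasSum_sum fun i hi ↦ hH i hi z hz

theorem exists_of_differentiableOn (hh : DifferentiableOn ℂ h (Metric.ball 0 1)) :
    ∃ H : PowerSeries ℂ, H.Represents h := by
  refine ⟨.mk fun n ↦ (n.factorial : ℂ)⁻¹ * iteratedDeriv n h 0, fun z hz ↦ ?_⟩
  have := Complex.hasSum_taylorSeries_on_ball hh (z := z) (by simpa using hz)
  convert! this using 2 with n
  simp
  ring

/-- The remainder of a convergent power series is a power of the variable times a function
which is again represented by a power series. -/
theorem exists_remainder (hH : H.Represents h) (n : ℕ) :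
    ∃ q : ℂ → ℂ, DifferentiableOn ℂ q (Metric.ball 0 1) ∧ ∀ z, ‖z‖ < 1 →
      h z = ∑ m ∈ Finset.range n, coeff m H * z ^ m + z ^ n * q z := by
  have hq : (PowerSeries.mk fun m ↦ coeff (m + n) H).Represents
      fun z ↦ ∑' m, coeff (m + n) H * z ^ m := by
    intro z hz
    simp only [coeff_mk]
    refine Summable.hasSum ?_
    rcases eq_or_ne z 0 with rfl | hz0
    · exact (hasSum_single 0 fun m hm ↦ by simp [hm]).summable
    · have h1 := ((summable_nat_add_iff n).2 (hH z hz).summable).mul_left (z ^ n)⁻¹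
      refine h1.congr fun m ↦ ?_
      have := pow_ne_zero n hz0
      rw [pow_add]
      field_simp
  refine ⟨_, hq.differentiableOn, fun z hz ↦ ?_⟩
  rw [← tsum_mul_left, ← (hH z hz).tsum_eq, ← (hH z hz).summable.sum_add_tsum_nat_add n]
  congr 1
  refine tsum_congr fun m ↦ ?_
  ring

theorem continuous_circleMap (hH : H.Represents h) {r : ℝ} (hr0 : 0 ≤ r) (hr1 : r < 1) :
    Continuous fun θ : ℝ ↦ h (circleMap 0 r θ) :=
  hH.differentiableOn.continuousOn.comp_continuous (_root_.continuous_circleMap 0 r)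
    fun θ ↦ by simpa [abs_of_nonneg hr0] using hr1

theorem integral_mul_conj_pow (hH : H.Represents h) {r : ℝ} (hr0 : 0 ≤ r) (hr1 : r < 1) (k : ℕ) :
    ∫ θ in (0 : ℝ)..2 * Real.pi, h (circleMap 0 r θ) * (starRingEnd ℂ) (circleMap 0 r θ ^ k) =
      2 * Real.pi * coeff k H * r ^ (2 * k) := by
  have hker (n : ℕ) : ∫ θ in (0 : ℝ)..2 * Real.pi,
      coeff n H * circleMap 0 r θ ^ n * (starRingEnd ℂ) (circleMap 0 r θ ^ k) =
        if n = k then 2 * Real.pi * coeff k H * r ^ (2 * k) else 0 := by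
    have hpt (θ : ℝ) : coeff n H * circleMap 0 r θ ^ n * (starRingEnd ℂ) (circleMap 0 r θ ^ k) =
        coeff n H * r ^ (n + k) * Complex.exp (((n : ℂ) - k) * Complex.I * θ) := by
      simp only [circleMap, zero_add, map_pow, map_mul, Complex.conj_ofReal, ← Complex.exp_conj,
        Complex.conj_I, map_natCast, mul_pow, ← Complex.exp_nat_mul]
      rw [show ((n : ℂ) - k) * Complex.I * θ = n * (θ * Complex.I) + k * (θ * -Complex.I) by ring,
        Complex.exp_add]
      ring
    simp only [hpt, intervalIntegral.integral_const_mul]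
    split_ifs with hnk
    · subst hnk
      simp
      ring
    · have h0 : ((n : ℂ) - k) * Complex.I ≠ 0 :=
        mul_ne_zero (sub_ne_zero.2 (by exact_mod_cast hnk)) Complex.I_ne_zero
      rw [integral_exp_mul_complex h0]
      have : Complex.exp (((n : ℂ) - k) * Complex.I * ((2 * Real.pi : ℝ) : ℂ)) = 1 :=
        Complex.exp_eq_one_iff.2 ⟨(n : ℤ) - k, by push_cast; ring⟩
      rw [this]
      simp
  have hs : HasSum (fun n ↦ ∫ θ in (0 : ℝ)..2 * Real.pi,
      coeff n H * circleMap 0 r θ ^ n * (starRingEnd ℂ) (circleMap 0 r θ ^ k))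
      (∫ θ in (0 : ℝ)..2 * Real.pi,
        h (circleMap 0 r θ) * (starRingEnd ℂ) (circleMap 0 r θ ^ k)) := by
    refine intervalIntegral.hasSum_integral_of_dominated_convergence
      (fun n _ ↦ ‖coeff n H * (r : ℂ) ^ n‖ * r ^ k) ?_ ?_ ?_ ?_ ?_
    · intro n
      exact Continuous.aestronglyMeasurable (by fun_prop)
    · intro n
      refine Filter.Eventually.of_forall fun θ _ ↦ ?_
      simp [abs_of_nonneg hr0]
    · refine Filter.Eventually.of_forall fun θ _ ↦ ?_
      exact (hH r (by simpa [abs_of_nonneg hr0] using hr1)).summable.norm.mul_right _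
    · exact intervalIntegrable_const
    · refine Filter.Eventually.of_forall fun θ _ ↦ ?_
      exact (hH _ (by simpa [abs_of_nonneg hr0] using hr1)).mul_right _
  simp only [hker] at hs
  exact (hs.unique (hasSum_ite_eq k _))

theorem integral_mul_conj_sum (hH : H.Represents h) {r : ℝ} (hr0 : 0 ≤ r) (hr1 : r < 1) (N : ℕ) :
    ∫ θ in (0 : ℝ)..2 * Real.pi, h (circleMap 0 r θ) *
      (starRingEnd ℂ) (∑ k ∈ Finset.range N, coeff k H * circleMap 0 r θ ^ k) =
      ((2 * Real.pi * ∑ k ∈ Finset.range N, ‖coeff k H‖ ^ 2 * r ^ (2 * k) : ℝ) : ℂ) := by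
  have hc := hH.continuous_circleMap hr0 hr1
  have hterm (k : ℕ) : Continuous fun θ : ℝ ↦ h (circleMap 0 r θ) *
      ((starRingEnd ℂ) (coeff k H) * (starRingEnd ℂ) (circleMap 0 r θ ^ k)) :=
    hc.mul (continuous_const.mul (Complex.continuous_conj.comp
      ((_root_.continuous_circleMap 0 r).pow k)))
  simp only [map_sum, map_mul, Finset.mul_sum]
  rw [intervalIntegral.integral_finsetSum fun k _ ↦ (hterm k).intervalIntegrable _ _]
  push_cast
  refine Finset.sum_congr rfl fun k _ ↦ ?_
  simp only [mul_left_comm _ ((starRingEnd ℂ) (coeff k H))]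
  rw [intervalIntegral.integral_const_mul, hH.integral_mul_conj_pow hr0 hr1,
    ← Complex.conj_mul']
  ring

theorem integral_norm_sq_eval_trunc (H : PowerSeries ℂ) {r : ℝ} (hr0 : 0 ≤ r) (hr1 : r < 1)
    (N : ℕ) :
    ∫ θ in (0 : ℝ)..2 * Real.pi, ‖(trunc N H).eval (circleMap 0 r θ)‖ ^ 2 =
      2 * Real.pi * ∑ k ∈ Finset.range N, ‖coeff k H‖ ^ 2 * r ^ (2 * k) := by
  have h := (coe_polynomial (trunc N H)).integral_mul_conj_sum hr0 hr1 N
  have hp (z : ℂ) : ∑ k ∈ Finset.range N, coeff k (trunc N H : PowerSeries ℂ) * z ^ k =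
      (trunc N H).eval z := by
    rw [Polynomial.eval, eval₂_trunc_eq_sum_range]
    exact Finset.sum_congr rfl fun k hk ↦ by
      rw [coeff_coe_trunc_of_lt (Finset.mem_range.1 hk), RingHom.id_apply]
  simp only [hp, Complex.mul_conj'] at h
  norm_cast at h
  rw [intervalIntegral.integral_ofReal, Complex.ofReal_inj] at h
  rw [h]
  congr 1
  exact Finset.sum_congr rfl fun k hk ↦ by rw [coeff_trunc, if_pos (Finset.mem_range.1 hk)]

theorem sum_le_integral (hH : H.Represents h) {r : ℝ} (hr0 : 0 ≤ r) (hr1 : r < 1) (N : ℕ) :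
    2 * Real.pi * ∑ k ∈ Finset.range N, ‖coeff k H‖ ^ 2 * r ^ (2 * k) ≤
      ∫ θ in (0 : ℝ)..2 * Real.pi, ‖h (circleMap 0 r θ)‖ ^ 2 := by
  have hc := hH.continuous_circleMap hr0 hr1
  have hP := (coe_polynomial (trunc N H)).continuous_circleMap hr0 hr1
  have h1 := hH.integral_mul_conj_sum hr0 hr1 N
  have h2 := integral_norm_sq_eval_trunc H hr0 hr1 N
  have hp (z : ℂ) : ∑ k ∈ Finset.range N, coeff k H * z ^ k = (trunc N H).eval z := by
    rw [Polynomial.eval, eval₂_trunc_eq_sum_range]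
    simp
  simp only [hp] at h1
  have hc1 : Continuous fun θ ↦ h (circleMap 0 r θ) *
      (starRingEnd ℂ) ((trunc N H).eval (circleMap 0 r θ)) :=
    hc.mul (Complex.continuous_conj.comp hP)
  have h3 := Complex.reCLM.intervalIntegral_comp_comm
    (hc1.intervalIntegrable (μ := MeasureTheory.volume) 0 (2 * Real.pi))
  rw [h1] at h3
  simp only [Complex.reCLM_apply, Complex.ofReal_re] at h3
  have hci : Continuous fun θ ↦ 2 * (h (circleMap 0 r θ) *
      (starRingEnd ℂ) ((trunc N H).eval (circleMap 0 r θ))).re :=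
    continuous_const.mul (Complex.continuous_re.comp hc1)
  have hc2 : Continuous fun θ ↦ ‖h (circleMap 0 r θ)‖ ^ 2 := hc.norm.pow 2
  have hP2 : Continuous fun θ ↦ ‖(trunc N H).eval (circleMap 0 r θ)‖ ^ 2 := hP.norm.pow 2
  have h4 : ∫ θ in (0 : ℝ)..2 * Real.pi, 2 * (h (circleMap 0 r θ) *
      (starRingEnd ℂ) ((trunc N H).eval (circleMap 0 r θ))).re ≤
      ∫ θ in (0 : ℝ)..2 * Real.pi, (‖h (circleMap 0 r θ)‖ ^ 2 +
        ‖(trunc N H).eval (circleMap 0 r θ)‖ ^ 2) := by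
    refine intervalIntegral.integral_mono Real.two_pi_pos.le (hci.intervalIntegrable _ _)
      ((hc2.add hP2).intervalIntegrable _ _) fun θ ↦ ?_
    have h5 := Complex.re_le_norm (h (circleMap 0 r θ) *
      (starRingEnd ℂ) ((trunc N H).eval (circleMap 0 r θ)))
    rw [norm_mul, RCLike.norm_conj] at h5
    dsimp only
    nlinarith [sq_nonneg (‖h (circleMap 0 r θ)‖ - ‖(trunc N H).eval (circleMap 0 r θ)‖)]
  rw [intervalIntegral.integral_const_mul, h3, intervalIntegral.integral_add
    (hc2.intervalIntegrable _ _) (hP2.intervalIntegrable _ _), h2] at h4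
  linarith

theorem isContractiveMultiplier (hH : H.Represents h) (hh : ∀ z, ‖z‖ < 1 → ‖h z‖ ≤ 1) :
    H.IsContractiveMultiplier := by
  intro N V
  have hprod := hH.mul (coe_polynomial (trunc N V))
  have hcoeff (k : ℕ) (hk : k ∈ Finset.range N) :
      coeff k (H * (trunc N V : PowerSeries ℂ)) = coeff k (H * V) := by
    rw [coeff_mul_eq_coeff_trunc_mul_trunc H V (Finset.mem_range.1 hk),
      coeff_mul_eq_coeff_trunc_mul_trunc H _ (Finset.mem_range.1 hk), trunc_trunc]
  have key (r : ℝ) (hr : r ∈ Set.Ico (0 : ℝ) 1) :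
      ∑ k ∈ Finset.range N, ‖coeff k (H * V)‖ ^ 2 * r ^ (2 * k) ≤
        ∑ k ∈ Finset.range N, ‖coeff k V‖ ^ 2 * r ^ (2 * k) := by
    refine le_of_mul_le_mul_left ?_ Real.two_pi_pos
    rw [← integral_norm_sq_eval_trunc V hr.1 hr.2]
    refine le_trans (le_of_eq ?_) ((hprod.sum_le_integral hr.1 hr.2 N).trans
      (intervalIntegral.integral_mono Real.two_pi_pos.le
        (((hprod.continuous_circleMap hr.1 hr.2).norm.pow 2).intervalIntegrable _ _)
        ((((coe_polynomial _).continuous_circleMap hr.1 hr.2).norm.pow 2).intervalIntegrable _ _)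
        fun θ ↦ ?_))
    · congr 1
      exact Finset.sum_congr rfl fun k hk ↦ by rw [hcoeff k hk]
    · dsimp only
      rw [norm_mul]
      gcongr
      exact mul_le_of_le_one_left (norm_nonneg _)
        (hh _ (by simpa [abs_of_nonneg hr.1] using hr.2))
  have hlim (W : PowerSeries ℂ) : ContinuousOn
      (fun r : ℝ ↦ ∑ k ∈ Finset.range N, ‖coeff k W‖ ^ 2 * r ^ (2 * k))
      (closure (Set.Ico (0 : ℝ) 1)) :=
    Continuous.continuousOn (by fun_prop)
  simpa using le_on_closure key (hlim _) (hlim _) (x := 1)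
    (by rw [closure_Ico zero_ne_one]; simp)

end PowerSeries.Represents

open PowerSeries in
/-- Composition formula for the coefficients of `g ∘ φ`, where `φ` fixes the origin. -/
theorem PowerSeries.Represents.coeff_comp {F G Φ : PowerSeries ℂ} {f g φ : ℂ → ℂ}
    (hF : F.Represents f) (hG : G.Represents g) (hΦ : Φ.Represents φ)
    (hΦ0 : constantCoeff Φ = 0) (hφ : ∀ z, ‖z‖ < 1 → ‖φ z‖ < 1)
    (hfg : ∀ z, ‖z‖ < 1 → f z = g (φ z)) (n : ℕ) :
    coeff n F = coeff n (∑ m ∈ Finset.range (n + 1), coeff m G • Φ ^ m) := by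
  obtain ⟨q, hq, hgq⟩ := hG.exists_remainder (n + 1)
  obtain ⟨Q, hQ⟩ := PowerSeries.Represents.exists_of_differentiableOn
    (hq.comp hΦ.differentiableOn fun z hz ↦ by simpa using hφ z (by simpa using hz))
  have hsum := (Represents.sum (Finset.range (n + 1)) fun m _ ↦ (hΦ.pow m).smul (coeff m G)).add
    ((hΦ.pow (n + 1)).mul hQ)
  rw [hF.unique (hsum.congr fun z hz ↦ ((hfg z hz).trans (hgq _ (hφ z hz))).symm), map_add,
    add_eq_left]
  exact X_pow_dvd_iff.1 ((pow_dvd_pow_of_dvd (X_dvd_iff.2 hΦ0) (n + 1)).mul_right Q) n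
    n.lt_succ_self


/-- Rogosinski's theorem for convex majorant sequences: if f is subordinate to g
on the unit disk and the coefficients Aₙ of g form a nonnegative, nondecreasing,
convex sequence with A₀ = 0, then the coefficients aₙ of f satisfy |aₙ| ≤ Aₙ. -/
theorem rogosinski_convex (f g φ : ℂ → ℂ)
    (pf pg : FormalMultilinearSeries ℂ ℂ ℂ)
    (hf : HasFPowerSeriesOnBall f pf 0 1)
    (hg : HasFPowerSeriesOnBall g pg 0 1)
    (hφ : AnalyticOn ℂ φ (Metric.ball (0 : ℂ) 1)) (hφ0 : φ 0 = 0)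
    (hφm : ∀ z ∈ Metric.ball (0 : ℂ) 1, φ z ∈ Metric.ball (0 : ℂ) 1)
    (hsub : ∀ z ∈ Metric.ball (0 : ℂ) 1, f z = g (φ z))
    (A : ℕ → ℝ) (hA : ∀ n, pg.coeff n = (A n : ℂ))
    (hA0 : A 0 = 0)
    (hnn : ∀ n, 0 ≤ A n)
    (hmono : ∀ n, A n ≤ A (n + 1))
    (hconv : ∀ n, A (n + 1) - A n ≤ A (n + 2) - A (n + 1)) :
    ∀ n : ℕ, 1 ≤ n → ‖pf.coeff n‖ ≤ A n := by
  intro n _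
  have hF := PowerSeries.Represents.of_hasFPowerSeriesOnBall hf
  have hG := PowerSeries.Represents.of_hasFPowerSeriesOnBall hg
  obtain ⟨Φ, hΦ⟩ := PowerSeries.Represents.exists_of_differentiableOn hφ.differentiableOn
  have hφm' (z : ℂ) (hz : ‖z‖ < 1) : ‖φ z‖ < 1 := by simpa using hφm z (by simpa using hz)
  have hΦ0 : PowerSeries.constantCoeff Φ = 0 := by
    rw [← hφ0, ← PowerSeries.coeff_zero_eq_constantCoeff_apply]
    refine HasSum.unique ?_ (hΦ 0 (by simp))
    simpa using hasSum_single (f := fun n ↦ PowerSeries.coeff n Φ * (0 : ℂ) ^ n) 0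
      fun n hn ↦ by simp [hn]
  have h := hF.coeff_comp hG hΦ hΦ0 hφm' (fun z hz ↦ hsub z (by simpa using hz)) n
  simp only [PowerSeries.coeff_mk, hA] at h
  rw [h]
  exact norm_coeff_sum_convex_smul_pow_le hΦ0
    (hΦ.isContractiveMultiplier fun z hz ↦ (hφm' z hz).le) hA0 (hnn 1) hconv n
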